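/- arXiv:2512.00957 — 2 statements merged into one kernel-verified Lean document; each statement's English description precedes it below -/
import Mathlib

section
/- Let X be a tree and g₁, g₂ hyperbolic automorphisms with translation lengths m₁ ≥ m₂ whose axes share a segment of length l satisfying 0 < l < m₂ (both translating in the same direction along the overlap). Then ⟨g₁, g₂⟩ is a free group of rank 2. -/
open SimpleGraph in
lemma aux_sep {V : Type*} (G : SimpleGraph V) (hT : G.IsTree) {a a' b c : V}
    (h : G.Adj a a') (hb : G.dist a' b < G.dist a b) (hc : G.dist a c < G.dist a' c) :
    G.dist b c = G.dist b a' + 1 + G.dist a c := by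
  classical
  obtain ⟨p, hp, hpl⟩ := hT.connected.exists_path_of_dist b a'
  obtain ⟨q, hq, hql⟩ := hT.connected.exists_path_of_dist a c
  obtain ⟨r, hr, hrl⟩ := hT.connected.exists_path_of_dist b c
  have hpath : (p.append (Walk.cons h.symm q)).IsPath := by
    rw [Walk.isPath_def, Walk.support_append, Walk.support_cons, List.tail_cons, List.nodup_append']
    refine ⟨hp.support_nodup, hq.support_nodup, ?_⟩
    intro u hu hu'
    have h1 := congrArg Walk.length (p.take_spec hu)
    have h2 := congrArg Walk.length (q.take_spec hu')
    rw [Walk.length_append] at h1 h2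
    have e1 := dist_le (p.takeUntil u hu)
    have e2 := dist_le (p.dropUntil u hu)
    have e3 := dist_le (q.takeUntil u hu')
    have e4 := dist_le (q.dropUntil u hu')
    have t1 := hT.connected.dist_triangle (u := a) (v := u) (w := b)
    have t2 := hT.connected.dist_triangle (u := a') (v := u) (w := c)
    have c1 := G.dist_comm (u := b) (v := u)
    have c2 := G.dist_comm (u := a') (v := u)
    have c3 := G.dist_comm (u := a') (v := b)
    omega
  have := (hT.existsUnique_path b c).unique hpath hr
  rw [← hrl, ← this, Walk.length_append, Walk.length_cons]
  omega

open SimpleGraph in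
/-- point at distance `k` along a geodesic -/
lemma aux_pt {V : Type*} (G : SimpleGraph V) (hT : G.IsTree) (a b : V) (k : ℕ)
    (hk : k ≤ G.dist a b) : ∃ w, G.dist a w = k ∧ G.dist w b + k = G.dist a b := by
  obtain ⟨p, hp⟩ := hT.connected.exists_walk_length_eq_dist a b
  have e1 := dist_le (p.take k)
  have e2 := dist_le (p.drop k)
  have t := hT.connected.dist_triangle (u := a) (v := p.getVert k) (w := b)
  rw [Walk.take_length] at e1
  rw [Walk.drop_length] at e2
  exact ⟨p.getVert k, by omega, by omega⟩

open SimpleGraph in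
lemma aux_four {V : Type*} (G : SimpleGraph V) (hT : G.IsTree) (n : ℕ) : ∀ a b c e : V,
    G.dist a b = n → G.dist a b + G.dist c e ≤
      max (G.dist a c + G.dist b e) (G.dist a e + G.dist b c) := by
  induction n with
  | zero =>
    intro a b c e h
    have hab := hT.connected.dist_eq_zero_iff.1 h
    subst hab
    have t := hT.connected.dist_triangle (u := c) (v := a) (w := e)
    have c1 := G.dist_comm (u := c) (v := a)
    omega
  | succ n ih =>
    intro a b c e h
    obtain ⟨a', h1, h2⟩ := aux_pt G hT a b 1 (by omega)
    have hadj : G.Adj a a' := dist_eq_one_iff_adj.1 h1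
    have key := ih a' b c e (by omega)
    have dc := hT.dist_eq_dist_add_one_of_adj c hadj
    have de := hT.dist_eq_dist_add_one_of_adj e hadj
    rw [G.dist_comm (u := c), G.dist_comm (u := c)] at dc
    rw [G.dist_comm (u := e), G.dist_comm (u := e)] at de
    have c1 := G.dist_comm (u := b) (v := a')
    have c2 := G.dist_comm (u := c) (v := a)
    have c3 := G.dist_comm (u := e) (v := a)
    have c4 := G.dist_comm (u := c) (v := e)
    rcases dc with dc | dc
    · rcases de with de | de
      · omega
      · have := aux_sep G hT hadj (b := b) (c := e) (by omega) (by omega)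
        have t := hT.connected.dist_triangle (u := e) (v := a) (w := c)
        omega
    · have := aux_sep G hT hadj (b := b) (c := c) (by omega) (by omega)
      have t := hT.connected.dist_triangle (u := c) (v := a) (w := e)
      omega

open SimpleGraph in
lemma aux_iso {V : Type*} (G : SimpleGraph V) (hT : G.IsTree) (g : Equiv.Perm V)
    (hg : ∀ v w, G.Adj (g v) (g w) ↔ G.Adj v w) (v w : V) :
    G.dist (g v) (g w) = G.dist v w := by
  have key : ∀ (f : G →g G) (v w : V), G.dist (f v) (f w) ≤ G.dist v w := by
    intro f v w
    obtain ⟨p, hp⟩ := hT.connected.exists_walk_length_eq_dist v w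
    have := dist_le (p.map f)
    rw [Walk.length_map] at this
    omega
  apply le_antisymm
  · exact key ⟨g, fun {a b} h => (hg a b).2 h⟩ v w
  · have := key ⟨g.symm, fun {a b} h => (hg _ _).1 (by simpa using h)⟩ (g v) (g w)
    simpa using this

/-- twice the Gromov product -/
noncomputable def auxP {V : Type*} (G : SimpleGraph V) (x a b : V) : ℤ :=
  (G.dist x a : ℤ) + G.dist x b - G.dist a b

lemma auxP_hyp {V : Type*} (G : SimpleGraph V) (hT : G.IsTree) (x a b c : V) :
    min (auxP G x a b) (auxP G x b c) ≤ auxP G x a c := by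
  have := aux_four G hT _ x b a c rfl
  have c1 := G.dist_comm (u := b) (v := a)
  unfold auxP
  omega

lemma auxP_comm {V : Type*} (G : SimpleGraph V) (x a b : V) :
    auxP G x a b = auxP G x b a := by
  have c1 := G.dist_comm (u := b) (v := a)
  unfold auxP
  omega

lemma aux_parity {V : Type*} (G : SimpleGraph V) (hT : G.IsTree) (x : V) (n : ℕ) : ∀ a b : V,
    G.dist a b = n → (G.dist x a + G.dist x b + n) % 2 = 0 := by
  induction n with
  | zero =>
    intro a b h
    have hab := hT.connected.dist_eq_zero_iff.1 h
    subst hab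
    omega
  | succ n ih =>
    intro a b h
    obtain ⟨a', h1, h2⟩ := aux_pt G hT a b 1 (by omega)
    have hadj : G.Adj a a' := SimpleGraph.dist_eq_one_iff_adj.1 h1
    have key := ih a' b (by omega)
    have dc := hT.dist_eq_dist_add_one_of_adj x hadj
    omega

lemma aux_branch {V : Type*} (G : SimpleGraph V) (hT : G.IsTree) (x a b : V) (k : ℕ)
    (h : 2 * (k : ℤ) - 1 ≤ auxP G x a b) :
    ∃ w, G.dist x w = k ∧ G.dist w a + k = G.dist x a ∧ G.dist w b + k = G.dist x b := by
  have t := hT.connected.dist_triangle (u := x) (v := a) (w := b)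
  have p := aux_parity G hT x _ a b rfl
  have h' : 2 * (k : ℤ) ≤ auxP G x a b := by unfold auxP at *; omega
  obtain ⟨w, h1, h2⟩ := aux_pt G hT x a k (by unfold auxP at h'; omega)
  refine ⟨w, h1, h2, ?_⟩
  have hy := auxP_hyp G hT x w a b
  have t := hT.connected.dist_triangle (u := x) (v := w) (w := b)
  unfold auxP at *
  omega

lemma aux_main {V : Type*} (G : SimpleGraph V) (hT : G.IsTree)
    (g : Bool → Equiv.Perm V) (hg : ∀ i v w, G.dist (g i v) (g i w) = G.dist v w)
    (m : Bool → ℕ) (hm : ∀ i w, m i ≤ G.dist w (g i w)) (x y : V)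
    (hov : ∀ w, (∀ i, G.dist w (g i w) = m i) → G.dist x w + G.dist w y = G.dist x y)
    (hx : ∀ i, G.dist x (g i x) = m i)
    (hdir : ∀ i, G.dist x y + G.dist y (g i x) = G.dist x (g i x))
    (h0 : 0 < G.dist x y) (hlt : ∀ i, G.dist x y < m i) :
    Function.Injective (FreeGroup.lift g : FreeGroup Bool →* Equiv.Perm V) := by
  have hx' : ∀ i, G.dist x ((g i).symm x) = m i := by
    intro i
    have := hg i ((g i).symm x) x
    rw [Equiv.apply_symm_apply, hx i, SimpleGraph.dist_comm] at this
    exact this.symm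
  have hgs : ∀ i v w, G.dist v ((g i).symm w) = G.dist (g i v) w := by
    intro i v w
    have := hg i v ((g i).symm w)
    rw [Equiv.apply_symm_apply] at this
    exact this.symm
  -- products
  have hA : ∀ i j, i ≠ j → auxP G x (g i x) (g j x) ≤ 2 * (G.dist x y : ℤ) := by
    intro i j hij
    by_contra hcon
    push Not at hcon
    obtain ⟨w, h1, h2, h3⟩ := aux_branch G hT x (g i x) (g j x) (G.dist x y + 1)
      (by push_cast; omega)
    have hk : ∀ k, G.dist w (g k x) + (G.dist x y + 1) = G.dist x (g k x) := by
      intro k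
      rcases Bool.eq_or_eq_not k i with h | h
      · rw [h]; exact h2
      · have : k = j := by revert h hij; clear * -; revert i j k; decide
        rw [this]; exact h3
    have := hov w (fun k => by
      have a1 := hm k w
      have a2 := hk k
      have a3 := hT.connected.dist_triangle (u := w) (v := g k x) (w := g k w)
      have a4 := hg k x w
      have a5 := hx k
      omega)
    omega
  have hB0 : ∀ i, auxP G x (g i x) ((g i).symm x) ≤ 0 := by
    intro i
    by_contra hcon
    push Not at hcon
    obtain ⟨w, h1, h2, h3⟩ := aux_branch G hT x (g i x) ((g i).symm x) 1
      (by push_cast; omega)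
    have a1 := hm i w
    have a2 := hgs i w x
    have a3 := hg i x w
    have a4 := aux_four G hT _ w (g i w) x (g i x) rfl
    have a5 := hx i
    have a6 := hx' i
    have a7 := hlt i
    have a8 := G.dist_comm (u := w) (v := x)
    have a9 := G.dist_comm (u := g i x) (v := g i w)
    omega
  have hy : ∀ i, auxP G x y (g i x) = 2 * (G.dist x y : ℤ) := by
    intro i
    have := hdir i
    unfold auxP
    omega
  have hB : ∀ i j, auxP G x (g i x) ((g j).symm x) ≤ 0 := by
    intro i j
    have a1 := auxP_hyp G hT x (g j x) y (g i x)
    have a2 := auxP_hyp G hT x (g j x) (g i x) ((g j).symm x)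
    have a3 := hB0 j
    have a4 := hy i
    have a5 := hy j
    rw [auxP_comm] at a5
    omega
  have hC : ∀ i j, i ≠ j → auxP G x ((g i).symm x) ((g j).symm x) ≤ 0 := by
    intro i j hij
    by_contra hcon
    push Not at hcon
    obtain ⟨w, h1, h2, h3⟩ := aux_branch G hT x ((g i).symm x) ((g j).symm x) 1
      (by push_cast; omega)
    have hk : ∀ k, G.dist w ((g k).symm x) + 1 = G.dist x ((g k).symm x) := by
      intro k
      rcases Bool.eq_or_eq_not k i with h | h
      · rw [h]; exact h2
      · have : k = j := by revert h hij; clear * -; revert i j k; decide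
        rw [this]; exact h3
    have a0 := hov w (fun k => by
      have a1 := hm k w
      have a2 := hk k
      have a3 := hT.connected.dist_triangle (u := w) (v := x) (w := g k w)
      have a4 := hgs k w x
      have a5 := hx' k
      have a6 := G.dist_comm (u := w) (v := x)
      have a7 := G.dist_comm (u := g k w) (v := x)
      omega)
    have b1 := auxP_hyp G hT x (g i x) y w
    have b2 := auxP_hyp G hT x (g i x) w ((g i).symm x)
    have b3 := hB0 i
    have b4 := hy i
    rw [auxP_comm] at b4
    have b5 : auxP G x y w = 2 := by
      have := G.dist_comm (u := w) (v := y)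
      unfold auxP; omega
    have b6 : auxP G x w ((g i).symm x) = 2 := by
      unfold auxP; omega
    omega
  -- ping-pong
  let a : ULift Bool → Equiv.Perm V := fun i => g i.down
  have hinj : Function.Injective (FreeGroup.lift a) := by
    apply FreeGroup.injective_lift_of_ping_pong a
      (fun i => {p | 2 * (G.dist x y : ℤ) < auxP G x p (g i.down x)})
      (fun i => {p | 0 < auxP G x p ((g i.down).symm x)})
    · rintro ⟨i⟩
      refine ⟨g i x, ?_⟩
      have := hx i
      have := hlt i
      simp only [Set.mem_ofPred_eq, auxP, SimpleGraph.dist_self]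
      omega
    · rintro ⟨i⟩ ⟨j⟩ hij
      refine Set.disjoint_left.2 fun p hp hq => ?_
      simp only [Set.mem_ofPred_eq] at hp hq
      have := hA i j (fun h => hij (by rw [h]))
      have := auxP_hyp G hT x (g i x) p (g j x)
      rw [auxP_comm] at hp
      omega
    · rintro ⟨i⟩ ⟨j⟩ hij
      refine Set.disjoint_left.2 fun p hp hq => ?_
      simp only [Set.mem_ofPred_eq] at hp hq
      have := hC i j (fun h => hij (by rw [h]))
      have := auxP_hyp G hT x ((g i).symm x) p ((g j).symm x)
      rw [auxP_comm] at hp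
      omega
    · rintro ⟨i⟩ ⟨j⟩
      refine Set.disjoint_left.2 fun p hp hq => ?_
      simp only [Set.mem_ofPred_eq] at hp hq
      have := hB i j
      have := auxP_hyp G hT x (g i x) p ((g j).symm x)
      rw [auxP_comm] at hp
      omega
    · rintro ⟨i⟩ _ ⟨p, hp, rfl⟩
      simp only [Set.mem_compl_iff, Set.mem_ofPred_eq, auxP] at hp
      simp only [Set.mem_ofPred_eq, auxP]
      change _ < (G.dist x (g i p) : ℤ) + _ - G.dist (g i p) _
      have a1 := hgs i p x
      have a2 := hx i
      have a3 := hx' i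
      have a4 := hg i p x
      have a5 := G.dist_comm (u := g i p) (v := x)
      have a6 := G.dist_comm (u := p) (v := x)
      have a7 := hlt i
      omega
    · rintro ⟨i⟩ _ ⟨p, hp, rfl⟩
      simp only [Set.mem_compl_iff, Set.mem_ofPred_eq, auxP] at hp
      simp only [Set.mem_ofPred_eq, auxP]
      change _ < (G.dist x ((g i).symm p) : ℤ) + _ - G.dist ((g i).symm p) _
      have a1 := hgs i ((g i).symm p) x
      rw [Equiv.apply_symm_apply] at a1
      have a2 := hx i
      have a3 := hx' i
      have a4 := hgs i x p
      have a5 := G.dist_comm (u := g i x) (v := p)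
      have a6 := G.dist_comm (u := p) (v := x)
      have a7 := hlt i
      omega
  have hcomp : (FreeGroup.lift g : FreeGroup Bool →* Equiv.Perm V) =
      (FreeGroup.lift a).comp (FreeGroup.freeGroupCongr Equiv.ulift.symm).toMonoidHom := by
    ext i
    simp [a]
  rw [hcomp, MonoidHom.coe_comp]
  exact hinj.comp (MulEquiv.injective _)


/-- If `g₁, g₂` are hyperbolic automorphisms of a tree with
translation lengths `m₁ ≥ m₂`, whose axes intersect exactly in a geodesic segment
`[v⁻, v⁺]` of length `l` with `0 < l < m₂`, both translating from `v⁻` toward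
`v⁺`, then `⟨g₁, g₂⟩` is free of rank 2. -/
theorem stmt_13 {V : Type*} (G : SimpleGraph V) (hT : G.IsTree)
    (g₁ g₂ : Equiv.Perm V)
    (hg₁ : ∀ v w, G.Adj (g₁ v) (g₁ w) ↔ G.Adj v w)
    (hg₂ : ∀ v w, G.Adj (g₂ v) (g₂ w) ↔ G.Adj v w)
    (hhyp₁ : ∀ v, g₁ v ≠ v) (hhyp₂ : ∀ v, g₂ v ≠ v)
    (hnoinv : ∀ h : Equiv.Perm V, h ∈ Subgroup.closure {g₁, g₂} →
      ∀ v w, G.Adj v w → ¬(h v = w ∧ h w = v))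
    (m₁ m₂ : ℕ)
    (hm₁ : m₁ = sInf (Set.range fun v => G.dist v (g₁ v)))
    (hm₂ : m₂ = sInf (Set.range fun v => G.dist v (g₂ v)))
    (h12 : m₂ ≤ m₁)
    (vm vp : V) (l : ℕ) (hl : l = G.dist vm vp)
    -- the intersection of the two axes is exactly the segment [v⁻, v⁺]:
    (hoverlap : ∀ w, (G.dist vm w + G.dist w vp = G.dist vm vp) ↔
      (G.dist w (g₁ w) = m₁ ∧ G.dist w (g₂ w) = m₂))
    -- both translate from v⁻ toward v⁺ (v⁺ lies between v⁻ and gᵢ v⁻):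
    (hdir₁ : G.dist vm vp + G.dist vp (g₁ vm) = G.dist vm (g₁ vm))
    (hdir₂ : G.dist vm vp + G.dist vp (g₂ vm) = G.dist vm (g₂ vm))
    (h0 : 0 < l) (hlt : l < m₂) :
    Function.Injective
      (FreeGroup.lift (fun b : Bool => if b then g₁ else g₂) :
        FreeGroup Bool →* Equiv.Perm V) := by
  have hx := (hoverlap vm).1 (by simp)
  apply aux_main G hT (fun b : Bool => if b then g₁ else g₂) (m := fun b => if b then m₁ else m₂)
    (x := vm) (y := vp)
  · intro i; cases i
    · exact aux_iso G hT g₂ hg₂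
    · exact aux_iso G hT g₁ hg₁
  · intro i w; cases i
    · simp only [Bool.false_eq_true, if_false]
      rw [hm₂]; exact Nat.sInf_le ⟨w, rfl⟩
    · simp only [if_true]
      rw [hm₁]; exact Nat.sInf_le ⟨w, rfl⟩
  · intro w hw
    exact (hoverlap w).2 ⟨by simpa using hw true, by simpa using hw false⟩
  · intro i; cases i
    · simpa using hx.2
    · simpa using hx.1
  · intro i; cases i
    · simpa using hdir₂
    · simpa using hdir₁
  · omega
  · intro i; cases i
    · simp; omega
    · simp; omega
end

section
/- Let m₁ ≥ m₂ > 0 be positive reals and suppose there exists a geodesic segment of length m₁ + m₂ in a locally finite tree along which two hyperbolic automorphisms with translation lengths m₁ and m₂ both translate. If m₂/m₁ is irrational, this is impossible; i.e., for hyperbolic g₁, g₂ in Aut(X, w) of a locally finite weighted tree with incommensurable translation lengths m₁, m₂, the overlap length l = ℓ(A_{g₁} ∩ A_{g₂}) satisfies l < m₁ + m₂. -/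
namespace Stmt16

theorem path_len {V : Type*} {G : SimpleGraph V} (hT : G.IsTree) {u v : V} (p : G.Walk u v)
    (hp : p.IsPath) : p.length = G.dist u v := by
  obtain ⟨q, hq, hl⟩ := hT.connected.exists_path_of_dist u v
  have := hT.IsAcyclic.path_unique ⟨p, hp⟩ ⟨q, hq⟩
  have h2 : p = q := congrArg Subtype.val this
  rw [h2, hl]

theorem append_path {V : Type*} {G : SimpleGraph V} {u c w : V} (p : G.Walk u c) (q : G.Walk c w)
    (hp : p.IsPath) (hq : q.IsPath) (h : ∀ x, x ∈ p.support → x ∈ q.support → x = c) :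
    (p.append q).IsPath := by
  rw [SimpleGraph.Walk.isPath_def] at *
  rw [SimpleGraph.Walk.support_append, List.nodup_append]
  rw [SimpleGraph.Walk.support_eq_cons q] at hq
  have hq' := List.nodup_cons.1 hq
  refine ⟨hp, hq'.2, ?_⟩
  rintro a ha b hb rfl
  have := h a ha (List.mem_of_mem_tail hb)
  subst this
  exact hq'.1 hb

theorem mem_iff {V : Type*} {G : SimpleGraph V} (hT : G.IsTree) {u w : V} (p : G.Walk u w)
    (hp : p.IsPath) (x : V) : x ∈ p.support ↔ G.dist u x + G.dist x w = G.dist u w := by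
  constructor
  · intro hx
    obtain ⟨q, r, hq, hr, rfl⟩ := hp.mem_support_iff_exists_append.1 hx
    rw [← path_len hT _ hp, ← path_len hT _ hq, ← path_len hT _ hr,
      SimpleGraph.Walk.length_append]
  · intro h
    obtain ⟨q, hq⟩ := hT.connected.exists_walk_length_eq_dist u x
    obtain ⟨r, hr⟩ := hT.connected.exists_walk_length_eq_dist x w
    have h1 : (q.append r).IsPath := by
      apply SimpleGraph.Walk.isPath_of_length_eq_dist
      rw [SimpleGraph.Walk.length_append, hq, hr, h]
    have h2 : p = q.append r :=
      congrArg Subtype.val (hT.IsAcyclic.path_unique ⟨p, hp⟩ ⟨_, h1⟩)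
    rw [h2, SimpleGraph.Walk.mem_support_append_iff]
    exact Or.inl q.end_mem_support

theorem median {V : Type*} {G : SimpleGraph V} (hT : G.IsTree) (u v w : V) :
    ∃ c, G.dist u c + G.dist c w = G.dist u w ∧ G.dist u c + G.dist c v = G.dist u v ∧
      G.dist v c + G.dist c w = G.dist v w := by
  classical
  obtain ⟨p, hp, -⟩ := hT.connected.exists_path_of_dist u w
  obtain ⟨c, hc, hmin⟩ := p.support.toFinset.exists_min_image (fun x => G.dist v x)
    ⟨u, by simp⟩
  simp only [List.mem_toFinset] at hc hmin
  obtain ⟨q, hq, hql⟩ := hT.connected.exists_path_of_dist v c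
  have key : ∀ x, x ∈ q.support → x ∈ p.support → x = c := by
    intro x hx hxp
    have h1 := (mem_iff hT q hq x).1 hx
    have h2 := hmin x hxp
    exact (hT.connected.dist_eq_zero_iff).1 (by omega)
  have hB := (mem_iff hT p hp c).1 hc
  obtain ⟨a, b, ha, hb, hab⟩ := hp.mem_support_iff_exists_append.1 hc
  have hsub : ∀ x, x ∈ a.support ∨ x ∈ b.support → x ∈ p.support := by
    intro x hx
    rw [hab, SimpleGraph.Walk.mem_support_append_iff]; exact hx
  refine ⟨c, hB, ?_, ?_⟩
  · have h3 := append_path a q.reverse ha hq.reverse (fun x hx hx' =>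
      key x (by simpa using hx') (hsub x (Or.inl hx)))
    exact (mem_iff hT _ h3 c).1 (by simp)
  · have h3 := append_path q b hq hb (fun x hx hx' => key x hx (hsub x (Or.inr hx')))
    exact (mem_iff hT _ h3 c).1 (by simp)

theorem linear {V : Type*} {G : SimpleGraph V} (hT : G.IsTree) {u w x y : V}
    (hx : G.dist u x + G.dist x w = G.dist u w) (hy : G.dist u y + G.dist y w = G.dist u w) :
    G.dist u x + G.dist x y = G.dist u y ∨ G.dist u y + G.dist y x = G.dist u x := by
  obtain ⟨p, hp, -⟩ := hT.connected.exists_path_of_dist u w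
  have hx' := (mem_iff hT p hp x).2 hx
  have hy' := (mem_iff hT p hp y).2 hy
  obtain ⟨a, b, ha, hb, hab⟩ := hp.mem_support_iff_exists_append.1 hy'
  rw [hab, SimpleGraph.Walk.mem_support_append_iff] at hx'
  rcases hx' with h | h
  · exact Or.inl ((mem_iff hT a ha x).1 h)
  · right
    have := (mem_iff hT b hb x).1 h
    have t := hT.connected.dist_triangle (u := u) (v := y) (w := x)
    omega

theorem dist_le_of_adj {V : Type*} {G : SimpleGraph V} (hT : G.IsTree) (g : V → V)
    (hg : ∀ v w, G.Adj v w → G.Adj (g v) (g w)) (u v : V) :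
    G.dist (g u) (g v) ≤ G.dist u v := by
  obtain ⟨p, hp⟩ := hT.connected.exists_walk_length_eq_dist u v
  let f : G →g G := ⟨g, fun {a b} h => hg a b h⟩
  have := SimpleGraph.dist_le (p.map f)
  rw [SimpleGraph.Walk.length_map, hp] at this
  exact this

theorem dist_perm {V : Type*} {G : SimpleGraph V} (hT : G.IsTree) (g : Equiv.Perm V)
    (hg : ∀ v w, G.Adj (g v) (g w) ↔ G.Adj v w) (u v : V) :
    G.dist (g u) (g v) = G.dist u v := by
  apply le_antisymm (dist_le_of_adj hT g (fun v w => (hg v w).2) u v)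
  have := dist_le_of_adj hT g.symm (fun v w h => (hg _ _).1 (by simpa using h)) (g u) (g v)
  simpa using this

theorem btw_of_d {V : Type*} {G : SimpleGraph V} (hT : G.IsTree) {d : V → V → ℝ}
    (hdsymm : ∀ v w, d v w = d w v)
    (hdzero : ∀ v w, d v w = 0 ↔ v = w)
    (hdadd : ∀ u v w, G.dist u v + G.dist v w = G.dist u w → d u v + d v w = d u w)
    {u v w : V} (h : d u v + d v w = d u w) : G.dist u v + G.dist v w = G.dist u w := by
  obtain ⟨c, h1, h2, h3⟩ := median hT u v w
  have e1 := hdadd _ _ _ h1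
  have e2 := hdadd _ _ _ h2
  have e3 := hdadd _ _ _ h3
  rw [hdsymm v c] at e3
  have : c = v := (hdzero c v).1 (by linarith)
  rw [← this]; exact h1

theorem order {V : Type*} {G : SimpleGraph V} (hT : G.IsTree) {d : V → V → ℝ}
    (hdsymm : ∀ v w, d v w = d w v)
    (hdzero : ∀ v w, d v w = 0 ↔ v = w)
    (hdnonneg : ∀ v w, 0 ≤ d v w)
    (hdadd : ∀ u v w, G.dist u v + G.dist v w = G.dist u w → d u v + d v w = d u w)
    {u w x y : V}
    (hx : G.dist u x + G.dist x w = G.dist u w) (hy : G.dist u y + G.dist y w = G.dist u w)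
    (hle : d u x ≤ d u y) : G.dist u x + G.dist x y = G.dist u y := by
  rcases linear hT hx hy with h | h
  · exact h
  · have e := hdadd _ _ _ h
    have : y = x := (hdzero _ _).1 (le_antisymm (by linarith) (hdnonneg _ _))
    subst this
    simp

/-- forward translation -/
theorem forward {V : Type*} {G : SimpleGraph V} (hT : G.IsTree) {d : V → V → ℝ}
    (hdsymm : ∀ v w, d v w = d w v)
    (hdzero : ∀ v w, d v w = 0 ↔ v = w)
    (hdnonneg : ∀ v w, 0 ≤ d v w)
    (hdadd : ∀ u v w, G.dist u v + G.dist v w = G.dist u w → d u v + d v w = d u w)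
    (g : Equiv.Perm V) (hgd : ∀ v w, d (g v) (g w) = d v w) {m : ℝ} {vm vp : V}
    (hseg : ∀ w, G.dist vm w + G.dist w vp = G.dist vm vp → d w (g w) = m)
    (hdir : d vm (g vp) = d vm vp + m) {w : V}
    (hw : G.dist vm w + G.dist w vp = G.dist vm vp) (hl : m ≤ d w vp) :
    (G.dist vm (g w) + G.dist (g w) vp = G.dist vm vp) ∧ d vm (g w) = d vm w + m ∧
      G.dist (g w) vp + G.dist vp (g vp) = G.dist (g w) (g vp) := by
  have hc := hT.connected
  have hvp := hseg vp (by simp)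
  have hB : G.dist vm vp + G.dist vp (g vp) = G.dist vm (g vp) :=
    btw_of_d hT hdsymm hdzero hdadd (by rw [hdir, hvp])
  have t1 := hc.dist_triangle (u := vm) (v := w) (w := g vp)
  have t2 := hc.dist_triangle (u := w) (v := vp) (w := g vp)
  have hB2 : G.dist w vp + G.dist vp (g vp) = G.dist w (g vp) := by omega
  have e2 := hdadd _ _ _ hB2
  have hw' := hseg w hw
  have hB3 : G.dist w (g w) + G.dist (g w) (g vp) = G.dist w (g vp) :=
    btw_of_d hT hdsymm hdzero hdadd (by rw [hw', hgd, ← e2, hvp]; ring)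
  have hB4 := order hT hdsymm hdzero hdnonneg hdadd hB3 hB2 (by rw [hw']; exact hl)
  have t3 := hc.dist_triangle (u := vm) (v := w) (w := g w)
  have t4 := hc.dist_triangle (u := vm) (v := g w) (w := vp)
  have hB5 : G.dist vm w + G.dist w (g w) = G.dist vm (g w) := by omega
  refine ⟨by omega, ?_, by omega⟩
  rw [← hdadd _ _ _ hB5, hw']

theorem backward {V : Type*} {G : SimpleGraph V} (hT : G.IsTree) {d : V → V → ℝ}
    (hdsymm : ∀ v w, d v w = d w v)
    (hdzero : ∀ v w, d v w = 0 ↔ v = w)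
    (hdnonneg : ∀ v w, 0 ≤ d v w)
    (hdadd : ∀ u v w, G.dist u v + G.dist v w = G.dist u w → d u v + d v w = d u w)
    (g : Equiv.Perm V) (hga : ∀ v w, G.Adj (g v) (g w) ↔ G.Adj v w)
    (hgd : ∀ v w, d (g v) (g w) = d v w) {m : ℝ} {vm vp : V}
    (hseg : ∀ w, G.dist vm w + G.dist w vp = G.dist vm vp → d w (g w) = m)
    (hdir : d vm (g vp) = d vm vp + m) (hm : m ≤ d vm vp) {x : V}
    (hx : G.dist vm x + G.dist x vp = G.dist vm vp) (hl : m ≤ d vm x) :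
    ∃ y, (G.dist vm y + G.dist y vp = G.dist vm vp) ∧ d vm y = d vm x - m := by
  have hc := hT.connected
  obtain ⟨f1, f2, f3⟩ := forward hT hdsymm hdzero hdnonneg hdadd g hgd hseg hdir (w := vm)
    (by simp) hm
  have h0 : d vm vm = 0 := (hdzero _ _).2 rfl
  have hB := order hT hdsymm hdzero hdnonneg hdadd f1 hx (by rw [f2, h0]; linarith)
  have e := hdadd _ _ _ hB
  have t1 := hc.dist_triangle (u := x) (v := vp) (w := g vp)
  have t2 := hc.dist_triangle (u := g vm) (v := x) (w := g vp)
  have p1 := dist_perm hT g hga vm (g.symm x)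
  have p2 := dist_perm hT g hga (g.symm x) vp
  have p3 := dist_perm hT g hga vm vp
  have q := hgd vm (g.symm x)
  rw [Equiv.apply_symm_apply] at p1 p2 q
  refine ⟨g.symm x, by omega, ?_⟩
  rw [← q]; linarith

end Stmt16

/-- In a locally finite weighted tree (weighted path metric `d` on
the vertices of a locally finite simplicial tree), if `g₁, g₂` are hyperbolic
isometric automorphisms with translation lengths `m₁ ≥ m₂ > 0` whose ratio
`m₂/m₁` is irrational, and their axes overlap along a segment `[v⁻, v⁺]` on which
both translate in the same direction, then the overlap length
`l = d(v⁻, v⁺)` satisfies `l < m₁ + m₂`. -/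
theorem stmt_16 {V : Type*} (G : SimpleGraph V) (hT : G.IsTree)
    (hlf : ∀ v, (G.neighborSet v).Finite)
    (d : V → V → ℝ)
    (hdsymm : ∀ v w, d v w = d w v)
    (hdzero : ∀ v w, d v w = 0 ↔ v = w)
    (hdnonneg : ∀ v w, 0 ≤ d v w)
    -- d is additive along combinatorial geodesics (it is the weighted path metric):
    (hdadd : ∀ u v w, G.dist u v + G.dist v w = G.dist u w → d u v + d v w = d u w)
    (hdedge : ∀ v w, G.Adj v w → 0 < d v w)
    (g₁ g₂ : Equiv.Perm V)
    (hg₁a : ∀ v w, G.Adj (g₁ v) (g₁ w) ↔ G.Adj v w)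
    (hg₂a : ∀ v w, G.Adj (g₂ v) (g₂ w) ↔ G.Adj v w)
    (hg₁d : ∀ v w, d (g₁ v) (g₁ w) = d v w)
    (hg₂d : ∀ v w, d (g₂ v) (g₂ w) = d v w)
    (m₁ m₂ : ℝ) (hm₁pos : 0 < m₁) (hm₂pos : 0 < m₂) (h21 : m₂ ≤ m₁)
    (hirr : Irrational (m₂ / m₁))
    -- m₁, m₂ are the minimal displacements (translation lengths):
    (hmin₁ : ∀ v, m₁ ≤ d v (g₁ v)) (hmin₂ : ∀ v, m₂ ≤ d v (g₂ v))
    (vm vp : V)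
    -- the segment [v⁻, v⁺] is contained in both axes:
    (hseg : ∀ w, G.dist vm w + G.dist w vp = G.dist vm vp →
      d w (g₁ w) = m₁ ∧ d w (g₂ w) = m₂)
    -- both translate from v⁻ toward v⁺ (gᵢ v⁺ lies beyond v⁺ at distance mᵢ):
    (hdir₁ : d vm (g₁ vp) = d vm vp + m₁)
    (hdir₂ : d vm (g₂ vp) = d vm vp + m₂) :
    d vm vp < m₁ + m₂ := by
  by_contra hcon
  push Not at hcon
  have h0 : d vm vm = 0 := (hdzero _ _).2 rfl
  have step : ∀ x : {x : V // G.dist vm x + G.dist x vp = G.dist vm vp},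
      ∃ y : {x : V // G.dist vm x + G.dist x vp = G.dist vm vp},
        d vm y = d vm x + m₁ ∨ d vm y = d vm x - m₂ := by
    rintro ⟨x, hx⟩
    by_cases h : m₂ ≤ d vm x
    · obtain ⟨y, hy, hy'⟩ := Stmt16.backward hT hdsymm hdzero hdnonneg hdadd g₂ hg₂a hg₂d
        (fun w hw => (hseg w hw).2) hdir₂ (by linarith) hx h
      exact ⟨⟨y, hy⟩, Or.inr hy'⟩
    · push Not at h
      have e := hdadd _ _ _ hx
      obtain ⟨h1, h2, -⟩ := Stmt16.forward hT hdsymm hdzero hdnonneg hdadd g₁ hg₁d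
        (fun w hw => (hseg w hw).1) hdir₁ hx (by linarith)
      exact ⟨⟨_, h1⟩, Or.inl h2⟩
  choose T hTs using step
  let s : ℕ → {x : V // G.dist vm x + G.dist x vp = G.dist vm vp} :=
    fun n => T^[n] ⟨vm, by simp⟩
  have hs : ∀ n, ∃ i j : ℕ, i + j = n ∧ d vm (s n) = i * m₁ - j * m₂ := by
    intro n
    induction n with
    | zero => exact ⟨0, 0, rfl, by simp [s, h0]⟩
    | succ n ih =>
      obtain ⟨i, j, hij, he⟩ := ih
      have hsn : s (n + 1) = T (s n) := Function.iterate_succ_apply' _ _ _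
      rcases hTs (s n) with h | h
      · exact ⟨i + 1, j, by omega, by rw [hsn, h, he]; push_cast; ring⟩
      · exact ⟨i, j + 1, by omega, by rw [hsn, h, he]; push_cast; ring⟩
  have hinj : Function.Injective s := by
    intro a b hab
    obtain ⟨i, j, hij, he⟩ := hs a
    obtain ⟨i', j', hij', he'⟩ := hs b
    rw [hab, he'] at he
    by_cases hj : j = j'
    · subst hj
      have : (i' : ℝ) = i := mul_right_cancel₀ hm₁pos.ne' (by linarith)
      have : i' = i := by exact_mod_cast this
      omega
    · exfalso
      have hj' : (j : ℝ) - j' ≠ 0 := sub_ne_zero.2 (by exact_mod_cast hj)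
      apply hirr
      refine ⟨((i : ℚ) - i') / ((j : ℚ) - j'), ?_⟩
      push_cast
      rw [div_eq_div_iff hj' hm₁pos.ne']
      linarith
  obtain ⟨p, hp, -⟩ := hT.connected.exists_path_of_dist vm vp
  have hfin : Finite {x : V // G.dist vm x + G.dist x vp = G.dist vm vp} := by
    apply Set.Finite.to_subtype (s := {x : V | G.dist vm x + G.dist x vp = G.dist vm vp})
    exact (List.finite_toSet p.support).subset (fun x hx => (Stmt16.mem_iff hT p hp x).2 hx)
  exact not_injective_infinite_finite s hinj
end
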